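/- Lyndon interpolation for GL: if GL ⊢ A → B, then there is a formula C such that w(C) ⊆ w(A) ∩ w(B), GL ⊢ A → C, and GL ⊢ C → B, where w(D) records literals occurring outside the scope of modal operators as themselves and literals occurring inside the scope of a modal operator as marked copies. -/

import Mathlib

/-- Modal formulas in negation normal form. -/
inductive Fml : Type where
  | pos : ℕ → Fml
  | neg : ℕ → Fml
  | top : Fml
  | bot : Fml
  | and : Fml → Fml → Fml
  | or : Fml → Fml → Fml
  | box : Fml → Fml
  | dia : Fml → Fml
  deriving DecidableEq

/-- De Morgan negation. -/
def Fml.negation : Fml → Fml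
  | .pos n => .neg n
  | .neg n => .pos n
  | .top => .bot
  | .bot => .top
  | .and A B => .or A.negation B.negation
  | .or A B => .and A.negation B.negation
  | .box A => .dia A.negation
  | .dia A => .box A.negation

def Fml.imp (A B : Fml) : Fml := .or A.negation B
def Fml.biimp (A B : Fml) : Fml := .and (A.imp B) (B.imp A)
def Fml.boxdot (A : Fml) : Fml := .and A (.box A)

/-- Boolean evaluation, with modal subformulas evaluated via `m` (diamonds dually). -/
def Fml.eval (v : ℕ → Bool) (m : Fml → Bool) : Fml → Bool
  | .pos n => v n
  | .neg n => !(v n)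
  | .top => true
  | .bot => false
  | .and A B => A.eval v m && B.eval v m
  | .or A B => A.eval v m || B.eval v m
  | .box A => m A
  | .dia A => !(m A.negation)

/-- Boolean tautologies. -/
def Fml.Taut (A : Fml) : Prop := ∀ v m, A.eval v m = true

/-- The Hilbert system for Gödel–Löb logic GLH. -/
inductive GLH : Fml → Prop where
  | taut (A) : A.Taut → GLH A
  | distr (A B) : GLH ((Fml.box (A.imp B)).imp ((Fml.box A).imp (Fml.box B)))
  | lob (A) : GLH ((Fml.box ((Fml.box A).imp A)).imp (Fml.box A))
  | mp (A B) : GLH (A.imp B) → GLH A → GLH B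
  | nec (A) : GLH A → GLH (Fml.box A)

/-- One-sided sequents: finite multisets of formulas. -/
abbrev Sequent := Multiset Fml

/-- Prefix every formula of a sequent with ◇. -/
def diaS (Γ : Sequent) : Sequent := Γ.map Fml.dia

def listSharp : List Fml → Fml
  | [] => .bot
  | [A] => A
  | A :: l => .or A (listSharp l)

/-- Γ^♯ : the disjunction of the formulas of Γ (⊥ if Γ is empty). -/
noncomputable def sharp (Γ : Sequent) : Fml := listSharp Γ.toList

def listConj : List Fml → Fml
  | [] => .top
  | [A] => A
  | A :: l => .and A (listConj l)

/-- The sequent calculus GL_Seq. -/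
inductive GLSeq : Sequent → Prop where
  | axA (Γ A) : GLSeq (A ::ₘ A.negation ::ₘ Γ)
  | axTop (Γ) : GLSeq (Fml.top ::ₘ Γ)
  | andR {Γ A B} : GLSeq (A ::ₘ Γ) → GLSeq (B ::ₘ Γ) → GLSeq (Fml.and A B ::ₘ Γ)
  | orR {Γ A B} : GLSeq (A ::ₘ B ::ₘ Γ) → GLSeq (Fml.or A B ::ₘ Γ)
  | boxGL {Γ Δ A} : GLSeq (A ::ₘ Fml.dia A.negation ::ₘ (Γ + diaS Γ)) →
      GLSeq (Fml.box A ::ₘ (diaS Γ + Δ))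

/-- One backward step of the K4-style rules: Γ is an initial sequent or the conclusion of
a rule all of whose premises lie in `S`. -/
def InfStep (S : Set Sequent) (Γ : Sequent) : Prop :=
  (∃ Δ A, Γ = A ::ₘ Fml.negation A ::ₘ Δ) ∨
  (∃ Δ, Γ = Fml.top ::ₘ Δ) ∨
  (∃ Δ A B, Γ = Fml.and A B ::ₘ Δ ∧ (A ::ₘ Δ) ∈ S ∧ (B ::ₘ Δ) ∈ S) ∨
  (∃ Δ A B, Γ = Fml.or A B ::ₘ Δ ∧ (A ::ₘ B ::ₘ Δ) ∈ S) ∨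
  (∃ Δ Θ A, Γ = Fml.box A ::ₘ (diaS Δ + Θ) ∧ (A ::ₘ (Δ + diaS Δ)) ∈ S)

/-- GL_∞ : Γ has a (possibly non-well-founded) proof in the K4-style system, coinductively:
Γ belongs to some set of sequents each of which is an initial sequent or the conclusion
of a rule with premises in the set. -/
def GLInf (Γ : Sequent) : Prop := ∃ S : Set Sequent, Γ ∈ S ∧ ∀ Δ ∈ S, InfStep S Δ

/-- Circular derivability relative to a history of ancestor sequents available for back-links. -/
inductive GLCircAux : List Sequent → Sequent → Prop where
  | axA (H Γ A) : GLCircAux H (A ::ₘ A.negation ::ₘ Γ)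
  | axTop (H Γ) : GLCircAux H (Fml.top ::ₘ Γ)
  | back {H Γ} : Γ ∈ H → GLCircAux H Γ
  | andR {H Γ A B} : GLCircAux ((Fml.and A B ::ₘ Γ) :: H) (A ::ₘ Γ) →
      GLCircAux ((Fml.and A B ::ₘ Γ) :: H) (B ::ₘ Γ) → GLCircAux H (Fml.and A B ::ₘ Γ)
  | orR {H Γ A B} : GLCircAux ((Fml.or A B ::ₘ Γ) :: H) (A ::ₘ B ::ₘ Γ) →
      GLCircAux H (Fml.or A B ::ₘ Γ)
  | boxR {H Γ Δ A} : GLCircAux ((Fml.box A ::ₘ (diaS Γ + Δ)) :: H) (A ::ₘ (Γ + diaS Γ)) →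
      GLCircAux H (Fml.box A ::ₘ (diaS Γ + Δ))

/-- GL_circ : circular proofs. -/
def GLCirc (Γ : Sequent) : Prop := GLCircAux [] Γ

/-- Circular derivations with assumption leaves. `CircDer H b hs bhs Γ` : a circular
derivation of Γ, with ancestor history `H`, `b` true iff a □-rule occurs on the path from
the root, non-boxed assumption leaves `hs` and boxed assumption leaves `bhs`. -/
inductive CircDer : List Sequent → Bool → List Sequent → List Sequent → Sequent → Prop where
  | axA (H b Γ A) : CircDer H b [] [] (A ::ₘ A.negation ::ₘ Γ)
  | axTop (H b Γ) : CircDer H b [] [] (Fml.top ::ₘ Γ)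
  | back {H Γ} (b) : Γ ∈ H → CircDer H b [] [] Γ
  | hypU (H Γ) : CircDer H false [Γ] [] Γ
  | hypB (H Γ) : CircDer H true [] [Γ] Γ
  | andR {H b Γ A B hs₁ bhs₁ hs₂ bhs₂} :
      CircDer ((Fml.and A B ::ₘ Γ) :: H) b hs₁ bhs₁ (A ::ₘ Γ) →
      CircDer ((Fml.and A B ::ₘ Γ) :: H) b hs₂ bhs₂ (B ::ₘ Γ) →
      CircDer H b (hs₁ ++ hs₂) (bhs₁ ++ bhs₂) (Fml.and A B ::ₘ Γ)
  | orR {H b Γ A B hs bhs} :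
      CircDer ((Fml.or A B ::ₘ Γ) :: H) b hs bhs (A ::ₘ B ::ₘ Γ) →
      CircDer H b hs bhs (Fml.or A B ::ₘ Γ)
  | boxR {H b Γ Δ A hs bhs} :
      CircDer ((Fml.box A ::ₘ (diaS Γ + Δ)) :: H) true hs bhs (A ::ₘ (Γ + diaS Γ)) →
      CircDer H b hs bhs (Fml.box A ::ₘ (diaS Γ + Δ))

/-- Propositional atoms occurring in a formula. -/
def Fml.atoms : Fml → Finset ℕ
  | .pos n => {n}
  | .neg n => {n}
  | .top => ∅
  | .bot => ∅
  | .and A B => A.atoms ∪ B.atoms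
  | .or A B => A.atoms ∪ B.atoms
  | .box A => A.atoms
  | .dia A => A.atoms

/-- All literals occurring in a formula (a literal is an atom with a polarity). -/
def Fml.lits : Fml → Finset (ℕ × Bool)
  | .pos n => {(n, true)}
  | .neg n => {(n, false)}
  | .top => ∅
  | .bot => ∅
  | .and A B => A.lits ∪ B.lits
  | .or A B => A.lits ∪ B.lits
  | .box A => A.lits
  | .dia A => A.lits

/-- u(A) : literals occurring outside the scope of all modal operators. -/
def Fml.uvoc : Fml → Finset (ℕ × Bool)
  | .pos n => {(n, true)}
  | .neg n => {(n, false)}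
  | .top => ∅
  | .bot => ∅
  | .and A B => A.uvoc ∪ B.uvoc
  | .or A B => A.uvoc ∪ B.uvoc
  | .box _ => ∅
  | .dia _ => ∅

/-- v(A) : literals occurring within the scope of a modal operator (to be marked). -/
def Fml.vvoc : Fml → Finset (ℕ × Bool)
  | .and A B => A.vvoc ∪ B.vvoc
  | .or A B => A.vvoc ∪ B.vvoc
  | .box A => A.lits
  | .dia A => A.lits
  | _ => ∅

/-- w(A) = u(A) ∪ v(A)°, where the second Boolean component marks literals. -/
def Fml.wvoc (A : Fml) : Finset ((ℕ × Bool) × Bool) :=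
  A.uvoc.image (fun L => (L, false)) ∪ A.vvoc.image (fun L => (L, true))

/-- w*(A) = w(A) ∪ w(A)°. -/
def Fml.wstar (A : Fml) : Finset ((ℕ × Bool) × Bool) :=
  A.wvoc ∪ A.wvoc.image (fun p => (p.1, true))

namespace LIP

theorem neg_neg (A : Fml) : A.negation.negation = A := by
  induction A <;> simp_all [Fml.negation]

theorem eval_neg (v : ℕ → Bool) (m : Fml → Bool) (A : Fml) :
    A.negation.eval v m = !(A.eval v m) := by
  induction A <;> simp_all [Fml.negation, Fml.eval, neg_neg]

theorem eval_imp (v : ℕ → Bool) (m : Fml → Bool) (A B : Fml) :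
    (A.imp B).eval v m = (!(A.eval v m) || B.eval v m) := by
  simp [Fml.imp, Fml.eval, eval_neg]

/-- Transitive, conversely well-founded Kripke models. -/
structure Mdl where
  W : Type
  R : W → W → Prop
  trans : ∀ x y z, R x y → R y z → R x z
  wf : WellFounded (fun x y => R y x)
  val : W → ℕ → Prop

def sat (M : Mdl) : M.W → Fml → Prop
  | w, .pos n => M.val w n
  | w, .neg n => ¬ M.val w n
  | _, .top => True
  | _, .bot => False
  | w, .and A B => sat M w A ∧ sat M w B
  | w, .or A B => sat M w A ∨ sat M w B
  | w, .box A => ∀ x, M.R w x → sat M x A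
  | w, .dia A => ∃ x, M.R w x ∧ sat M x A

theorem sat_neg (M : Mdl) (A : Fml) : ∀ w, sat M w A.negation ↔ ¬ sat M w A := by
  induction A with
  | and A B hA hB => intro w; simp only [Fml.negation, sat, hA, hB]; tauto
  | or A B hA hB => intro w; simp only [Fml.negation, sat, hA, hB]; tauto
  | box A h => intro w; simp [Fml.negation, sat, h]
  | dia A h => intro w; simp [Fml.negation, sat, h]
  | _ => intro w; simp [Fml.negation, sat]

theorem sat_imp (M : Mdl) (A B : Fml) (w : M.W) :
    sat M w (A.imp B) ↔ (sat M w A → sat M w B) := by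
  simp only [Fml.imp, sat, sat_neg]; tauto

open Classical in
theorem sat_eval (M : Mdl) (w : M.W) (A : Fml) :
    (A.eval (fun n => decide (M.val w n))
      (fun B => decide (∀ x, M.R w x → sat M x B)) = true) ↔ sat M w A := by
  induction A <;> simp_all [Fml.eval, sat, sat_neg]

theorem soundness {A : Fml} (h : GLH A) (M : Mdl) : ∀ w : M.W, sat M w A := by
  induction h with
  | taut A h => intro w; exact (sat_eval M w A).1 (h _ _)
  | distr A B =>
    intro w
    simp only [sat_imp, sat]
    intro h1 h2 x hx
    exact h1 x hx (h2 x hx)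
  | lob A =>
    intro w
    simp only [sat_imp, sat]
    intro h1 x
    induction x using M.wf.induction with
    | _ x ih =>
      intro hx
      exact h1 x hx (fun y hy => ih y hy (M.trans _ _ _ hx hy))
  | mp A B _ _ h1 h2 => intro w; exact (sat_imp M A B w).1 (h1 w) (h2 w)
  | nec A _ h => intro w x _; exact h x

/-! Completeness. -/

/-- Theories. -/
structure Thy (T : Set Fml) : Prop where
  ax : ∀ A, GLH A → A ∈ T
  mp : ∀ A B, A.imp B ∈ T → A ∈ T → B ∈ T

theorem Thy.taut1 {T : Set Fml} (hT : Thy T) {A B : Fml} (h : (A.imp B).Taut) (hA : A ∈ T) :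
    B ∈ T := hT.mp _ _ (hT.ax _ (.taut _ h)) hA

theorem Thy.taut2 {T : Set Fml} (hT : Thy T) {A B C : Fml} (h : (A.imp (B.imp C)).Taut)
    (hA : A ∈ T) (hB : B ∈ T) : C ∈ T := hT.mp _ _ (hT.taut1 h hA) hB

theorem thyGLH : Thy {A | GLH A} := ⟨fun _ h => h, fun A B h1 h2 => GLH.mp A B h1 h2⟩

theorem Thy.ext {T : Set Fml} (hT : Thy T) (A : Fml) : Thy {B | A.imp B ∈ T} := by
  constructor
  · intro B hB
    refine hT.taut1 (A := B) ?_ (hT.ax _ hB)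
    intro v m; simp only [eval_imp]; cases A.eval v m <;> cases B.eval v m <;> rfl
  · intro B C h1 h2
    refine hT.taut2 ?_ h1 h2
    intro v m; simp only [eval_imp]
    cases A.eval v m <;> cases B.eval v m <;> cases C.eval v m <;> rfl

theorem Thy.boxed {T : Set Fml} (hT : Thy T) : Thy {B | Fml.box B ∈ T} := by
  constructor
  · intro B hB
    exact hT.ax _ (.nec _ hB)
  · intro B C h1 h2
    exact hT.mp _ _ (hT.mp _ _ (hT.ax _ (.distr B C)) h1) h2

structure MCS (T : Set Fml) : Prop extends Thy T where
  cons : Fml.bot ∉ T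
  max : ∀ A, A ∈ T ∨ A.negation ∈ T

theorem lindenbaum {T : Set Fml} (hT : Thy T) (hc : Fml.bot ∉ T) : ∃ S, T ⊆ S ∧ MCS S := by
  obtain ⟨S, hTS, hS⟩ := zorn_subset_nonempty {S : Set Fml | Thy S ∧ Fml.bot ∉ S} (by
    intro c hc hch hne
    obtain ⟨s0, hs0⟩ := hne
    refine ⟨⋃₀ c, ⟨⟨?_, ?_⟩, ?_⟩, fun s hs => Set.subset_sUnion_of_mem hs⟩
    · intro A hA; exact ⟨s0, hs0, (hc hs0).1.ax A hA⟩
    · rintro A B ⟨s, hs, h1⟩ ⟨t, ht, h2⟩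
      rcases hch.total hs ht with h | h
      · exact ⟨t, ht, (hc ht).1.mp A B (h h1) h2⟩
      · exact ⟨s, hs, (hc hs).1.mp A B h1 (h h2)⟩
    · rintro ⟨s, hs, h1⟩
      exact (hc hs).2 h1) T ⟨hT, hc⟩
  refine ⟨S, hTS, hS.prop.1, hS.prop.2, ?_⟩
  intro A
  by_cases h : Fml.bot ∈ {B | A.imp B ∈ S}
  · right
    refine hS.prop.1.taut1 ?_ h
    intro v m; simp only [eval_imp, eval_neg, Fml.eval]
    cases A.eval v m <;> rfl
  · left
    have hle : S ⊆ {B | A.imp B ∈ S} := by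
      intro B hB
      refine hS.prop.1.taut1 ?_ hB
      intro v m; simp only [eval_imp]; cases A.eval v m <;> cases B.eval v m <;> rfl
    have := hS.le_of_ge ⟨hS.prop.1.ext A, h⟩ hle
    apply this
    refine hS.prop.1.ax _ (.taut _ ?_)
    intro v m; simp only [eval_imp]; cases A.eval v m <;> rfl

theorem MCS.neg_iff {T : Set Fml} (h : MCS T) (A : Fml) : A.negation ∈ T ↔ A ∉ T := by
  constructor
  · intro h1 h2
    refine h.cons (h.taut2 ?_ h1 h2)
    intro v m; simp only [eval_imp, eval_neg, Fml.eval]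
    cases A.eval v m <;> rfl
  · intro h1
    exact (h.max A).resolve_left h1

theorem MCS.and_iff {T : Set Fml} (h : MCS T) (A B : Fml) : A.and B ∈ T ↔ A ∈ T ∧ B ∈ T := by
  refine ⟨fun h1 => ⟨h.taut1 ?_ h1, h.taut1 ?_ h1⟩, fun ⟨h1, h2⟩ => h.taut2 ?_ h1 h2⟩ <;>
  · intro v m; simp only [eval_imp, Fml.eval]
    cases A.eval v m <;> cases B.eval v m <;> rfl

theorem MCS.or_iff {T : Set Fml} (h : MCS T) (A B : Fml) : A.or B ∈ T ↔ A ∈ T ∨ B ∈ T := by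
  have := h.neg_iff (A.or B)
  have h2 := h.and_iff A.negation B.negation
  simp only [Fml.negation] at this
  rw [h.neg_iff, h.neg_iff] at h2
  tauto

theorem four (A : Fml) {T : Set Fml} (hT : Thy T) (h : Fml.box A ∈ T) :
    Fml.box (Fml.box A) ∈ T := by
  set G := A.and (.box A) with hG
  have t1 : ((Fml.box G).imp (.box A)).Taut → True := fun _ => trivial
  have hB := hT.boxed
  have e1 : GLH ((Fml.box G).imp (.box A)) := by
    refine GLH.mp _ _ (GLH.distr _ _) (GLH.nec _ (GLH.taut _ ?_))
    intro v m; simp only [hG, eval_imp, Fml.eval]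
    cases A.eval v m <;> cases m A <;> rfl
  have e2 : (Fml.box G).imp G ∈ {B | Fml.box B ∈ T} := by
    refine hB.taut2 ?_ (hB.ax _ e1) h
    intro v m; simp only [hG, eval_imp, Fml.eval]
    cases A.eval v m <;> cases m A <;> cases m (A.and (.box A)) <;> rfl
  have e3 : Fml.box G ∈ T := hT.mp _ _ (hT.ax _ (.lob G)) e2
  refine hB.taut1 (A := G) ?_ e3
  intro v m; simp only [hG, eval_imp, Fml.eval]
  cases A.eval v m <;> cases m A <;> rfl

theorem succ_exists {T : Set Fml} (h : MCS T) (E : Fml) (hE : Fml.box E ∉ T) :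
    ∃ S, MCS S ∧ (∀ G, Fml.box G ∈ T → G ∈ S ∧ Fml.box G ∈ S) ∧ Fml.box E ∈ S ∧
      E.negation ∈ S := by
  have hB := h.toThy.boxed
  have h1 := (hB.ext (.box E)).ext E.negation
  obtain ⟨S, hS, hm⟩ := lindenbaum h1 (by
    intro hb
    apply hE
    refine h.toThy.mp _ _ (h.toThy.ax _ (.lob E)) ?_
    refine hB.taut1 ?_ hb
    intro v m; simp only [eval_imp, eval_neg, Fml.eval]
    cases E.eval v m <;> cases m E <;> rfl)
  have key : ∀ G, Fml.box G ∈ T → G ∈ S := by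
    intro G hG
    apply hS
    refine hB.taut1 (A := G) ?_ hG
    intro v m; simp only [eval_imp, eval_neg, Fml.eval]
    cases E.eval v m <;> cases m E <;> cases G.eval v m <;> rfl
  refine ⟨S, hm, fun G hG => ⟨key G hG, key _ (four G h.toThy hG)⟩, hS ?_, hS ?_⟩ <;>
  · refine hB.ax _ (.taut _ ?_)
    intro v m; simp only [eval_imp, eval_neg, Fml.eval]
    cases E.eval v m <;> cases m E <;> rfl

/-- Bodies of boxes (diamonds dually). -/
def bodies : Fml → Finset Fml
  | .and A B => bodies A ∪ bodies B
  | .or A B => bodies A ∪ bodies B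
  | .box A => insert A (bodies A)
  | .dia A => insert A.negation (bodies A)
  | _ => ∅

open Classical in
noncomputable def canon (X : Finset Fml) : Mdl where
  W := {T : Set Fml // MCS T}
  R := fun w x => (∀ G, Fml.box G ∈ w.1 → G ∈ x.1 ∧ Fml.box G ∈ x.1) ∧
    ∃ E ∈ X, Fml.box E ∉ w.1 ∧ Fml.box E ∈ x.1
  trans := by
    rintro x y z ⟨h1, E, hE, h2, h3⟩ ⟨h4, -⟩
    exact ⟨fun G hG => h4 G (h1 G hG).2, E, hE, h2, (h4 E h3).2⟩
  wf := by
    refine Subrelation.wf (r := InvImage (· < ·)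
      (fun w : {T : Set Fml // MCS T} => (X.filter (fun E => Fml.box E ∉ w.1)).card)) ?_
      (InvImage.wf _ wellFounded_lt)
    rintro x w ⟨h1, E, hE, h2, h3⟩
    apply Finset.card_lt_card
    rw [Finset.ssubset_iff_of_subset]
    · exact ⟨E, by simp [hE, h2], by simp [h3]⟩
    · intro G
      simp only [Finset.mem_filter]
      exact fun ⟨hG, h⟩ => ⟨hG, fun h' => h (h1 G h').2⟩
  val := fun w n => Fml.pos n ∈ w.1

theorem truth (X : Finset Fml) (D : Fml) : bodies D ⊆ X → ∀ w : (canon X).W,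
    sat (canon X) w D ↔ D ∈ w.1 := by
  induction D with
  | pos n => intro _ w; exact Iff.rfl
  | neg n => intro _ w; exact (w.2.neg_iff (.pos n)).symm
  | top =>
    intro _ w
    simp only [sat, true_iff]
    exact w.2.ax _ (.taut _ (fun _ _ => rfl))
  | bot => intro _ w; simp only [sat, false_iff]; exact w.2.cons
  | and A B hA hB =>
    intro h w
    simp only [bodies, Finset.union_subset_iff] at h
    rw [w.2.and_iff, sat, hA h.1, hB h.2]
  | or A B hA hB =>
    intro h w
    simp only [bodies, Finset.union_subset_iff] at h
    rw [w.2.or_iff, sat, hA h.1, hB h.2]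
  | box A hA =>
    intro h w
    simp only [bodies, Finset.insert_subset_iff] at h
    constructor
    · intro h1
      by_contra hn
      obtain ⟨S, hS, h2, h3, h4⟩ := succ_exists w.2 A hn
      have := (hA h.2 ⟨S, hS⟩).1 (h1 ⟨S, hS⟩ ⟨h2, A, h.1, hn, h3⟩)
      exact (hS.neg_iff A).1 h4 this
    · intro h1 x hx
      exact (hA h.2 x).2 (hx.1 A h1).1
  | dia A hA =>
    intro h w
    simp only [bodies, Finset.insert_subset_iff] at h
    have e : A.dia = (Fml.box A.negation).negation := by simp [Fml.negation, neg_neg]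
    rw [e, w.2.neg_iff, ← e]
    constructor
    · rintro ⟨x, hx, h1⟩ h2
      exact (x.2.neg_iff A).1 (hx.1 _ h2).1 ((hA h.2 x).1 h1)
    · intro hn
      obtain ⟨S, hS, h2, h3, h4⟩ := succ_exists w.2 _ hn
      rw [neg_neg] at h4
      exact ⟨⟨S, hS⟩, ⟨h2, _, h.1, hn, h3⟩, (hA h.2 ⟨S, hS⟩).2 h4⟩

theorem completeness {A : Fml} (h : ∀ (M : Mdl) (w : M.W), sat M w A) : GLH A := by
  by_contra hn
  obtain ⟨S, hS, hm⟩ := lindenbaum (thyGLH.ext A.negation) (by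
    intro hb
    apply hn
    refine thyGLH.taut1 ?_ hb
    intro v m; simp only [eval_imp, eval_neg, Fml.eval]
    cases A.eval v m <;> rfl)
  have h1 : A.negation ∈ S := hS (GLH.taut _ (by
    intro v m; simp only [eval_imp]
    cases A.negation.eval v m <;> rfl))
  exact (hm.neg_iff A).1 h1 ((truth (bodies A) A subset_rfl ⟨S, hm⟩).1 (h _ _))

/-! Vocabulary and characteristic formulas. -/

noncomputable def conj (S : Finset Fml) : Fml := S.toList.foldr Fml.and Fml.top
noncomputable def disj (S : Finset Fml) : Fml := S.toList.foldr Fml.or Fml.bot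

theorem sat_conj (M : Mdl) (w : M.W) (S : Finset Fml) :
    sat M w (conj S) ↔ ∀ A ∈ S, sat M w A := by
  have : ∀ l : List Fml, sat M w (l.foldr Fml.and Fml.top) ↔ ∀ A ∈ l, sat M w A := by
    intro l; induction l <;> simp_all [sat]
  simp [conj, this]

theorem sat_disj (M : Mdl) (w : M.W) (S : Finset Fml) :
    sat M w (disj S) ↔ ∃ A ∈ S, sat M w A := by
  have : ∀ l : List Fml, sat M w (l.foldr Fml.or Fml.bot) ↔ ∃ A ∈ l, sat M w A := by
    intro l; induction l <;> simp_all [sat]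
  simp [disj, this]

abbrev Voc := Finset (ℕ × Bool)

def InVoc (U V : Voc) (D : Fml) : Prop := D.uvoc ⊆ U ∧ D.vvoc ⊆ V

theorem lits_eq (D : Fml) : D.lits = D.uvoc ∪ D.vvoc := by
  induction D <;> simp_all [Fml.lits, Fml.uvoc, Fml.vvoc]
  all_goals ac_rfl

theorem inVoc_lits (V : Voc) (D : Fml) : InVoc V V D ↔ D.lits ⊆ V := by
  rw [lits_eq, Finset.union_subset_iff, InVoc]

theorem inVoc_conj (U V : Voc) (S : Finset Fml) (h : ∀ A ∈ S, InVoc U V A) :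
    InVoc U V (conj S) := by
  have : ∀ l : List Fml, (∀ A ∈ l, InVoc U V A) → InVoc U V (l.foldr Fml.and Fml.top) := by
    intro l; induction l <;> simp_all [InVoc, Fml.uvoc, Fml.vvoc, Finset.union_subset_iff]
  exact this _ (by simpa using h)

theorem inVoc_disj (U V : Voc) (S : Finset Fml) (h : ∀ A ∈ S, InVoc U V A) :
    InVoc U V (disj S) := by
  have : ∀ l : List Fml, (∀ A ∈ l, InVoc U V A) → InVoc U V (l.foldr Fml.or Fml.bot) := by
    intro l; induction l <;> simp_all [InVoc, Fml.uvoc, Fml.vvoc, Finset.union_subset_iff]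
  exact this _ (by simpa using h)

def lit : ℕ × Bool → Fml
  | (n, true) => .pos n
  | (n, false) => .neg n

noncomputable def F (V : Voc) : ℕ → Voc → Finset Fml
  | 0, U => U.image lit
  | k + 1, U => U.image lit ∪ ((F V k V).powerset.image (fun S => Fml.dia (conj S)) ∪
      (F V k V).powerset.image (fun S => Fml.box (disj S)))

theorem F_voc (V : Voc) (k : ℕ) : ∀ U, ∀ D ∈ F V k U, InVoc U V D := by
  have hl : ∀ U : Voc, ∀ D ∈ U.image lit, InVoc U V D := by
    intro U D hD
    simp only [Finset.mem_image] at hD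
    obtain ⟨⟨n, b⟩, h, rfl⟩ := hD
    cases b <;> simp [lit, InVoc, Fml.uvoc, Fml.vvoc, h]
  induction k with
  | zero => intro U D hD; exact hl U D hD
  | succ k ih =>
    intro U D hD
    simp only [F, Finset.mem_union] at hD
    rcases hD with hD | hD | hD
    · exact hl U D hD
    · simp only [Finset.mem_image, Finset.mem_powerset] at hD
      obtain ⟨S, hS, rfl⟩ := hD
      have := (inVoc_lits V _).1 (inVoc_conj V V S (fun A hA => ih V A (hS hA)))
      simpa [InVoc, Fml.uvoc, Fml.vvoc] using this
    · simp only [Finset.mem_image, Finset.mem_powerset] at hD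
      obtain ⟨S, hS, rfl⟩ := hD
      have := (inVoc_lits V _).1 (inVoc_disj V V S (fun A hA => ih V A (hS hA)))
      simpa [InVoc, Fml.uvoc, Fml.vvoc] using this

theorem lit_mem (V U : Voc) (k : ℕ) (L : ℕ × Bool) (h : L ∈ U) : lit L ∈ F V k U := by
  cases k with
  | zero => exact Finset.mem_image_of_mem _ h
  | succ k => exact Finset.mem_union_left _ (Finset.mem_image_of_mem _ h)

/-- Bounded simulation. -/
def Sim (M N : Mdl) (V : Voc) (k : ℕ) (U : Voc) (a : M.W) (b : N.W) : Prop :=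
  ∀ D ∈ F V k U, sat M a D → sat N b D

open Classical in
theorem sim_forth {M N : Mdl} {V : Voc} {k : ℕ} {U : Voc} {a : M.W} {b : N.W}
    (h : Sim M N V (k + 1) U a b) (a' : M.W) (ha : M.R a a') :
    ∃ b', N.R b b' ∧ Sim M N V k V a' b' := by
  set S := (F V k V).filter (fun D => sat M a' D) with hS
  have hm : Fml.dia (conj S) ∈ F V (k + 1) U := by
    apply Finset.mem_union_right
    apply Finset.mem_union_left
    exact Finset.mem_image_of_mem (fun S => Fml.dia (conj S))
      (Finset.mem_powerset.2 (Finset.filter_subset _ _))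
  have h1 : sat M a (Fml.dia (conj S)) :=
    ⟨a', ha, (sat_conj M a' S).2 (fun A hA => (Finset.mem_filter.1 hA).2)⟩
  obtain ⟨b', hb, h2⟩ := h _ hm h1
  exact ⟨b', hb, fun D hD hs => (sat_conj N b' S).1 h2 D (Finset.mem_filter.2 ⟨hD, hs⟩)⟩

open Classical in
theorem sim_back {M N : Mdl} {V : Voc} {k : ℕ} {U : Voc} {a : M.W} {b : N.W}
    (h : Sim M N V (k + 1) U a b) (b' : N.W) (hb : N.R b b') :
    ∃ a', M.R a a' ∧ Sim M N V k V a' b' := by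
  set S := (F V k V).filter (fun D => ¬ sat N b' D) with hS
  have hm : Fml.box (disj S) ∈ F V (k + 1) U := by
    apply Finset.mem_union_right
    apply Finset.mem_union_right
    exact Finset.mem_image_of_mem (fun S => Fml.box (disj S))
      (Finset.mem_powerset.2 (Finset.filter_subset _ _))
  by_contra hcon
  push Not at hcon
  have h1 : sat M a (Fml.box (disj S)) := by
    intro a' ha
    by_contra hd
    apply hcon a' ha
    intro D hD hs
    by_contra hn
    exact hd ((sat_disj M a' S).2 ⟨D, Finset.mem_filter.2 ⟨hD, hn⟩, hs⟩)
  obtain ⟨D, hD, h2⟩ := (sat_disj N b' S).1 (h _ hm h1 b' hb)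
  exact (Finset.mem_filter.1 hD).2 h2

/-! Amalgamation. -/

open Classical in
/-- Number of elements of `X` true somewhere above `a`. -/
noncomputable def cntD (M : Mdl) (X : Finset Fml) (a : M.W) : ℕ :=
  (X.filter (fun D => sat M a (.dia D))).card

open Classical in
noncomputable def cntB (M : Mdl) (X : Finset Fml) (a : M.W) : ℕ :=
  (X.filter (fun D => ¬ sat M a (.box D))).card

theorem cntD_le (M : Mdl) (X : Finset Fml) {a a' : M.W} (h : M.R a a') :
    cntD M X a' ≤ cntD M X a := by
  classical
  apply Finset.card_le_card
  intro D
  simp only [Finset.mem_filter]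
  rintro ⟨hD, x, hx, hs⟩
  exact ⟨hD, x, M.trans _ _ _ h hx, hs⟩

theorem cntB_le (M : Mdl) (X : Finset Fml) {a a' : M.W} (h : M.R a a') :
    cntB M X a' ≤ cntB M X a := by
  classical
  apply Finset.card_le_card
  intro D
  simp only [Finset.mem_filter]
  rintro ⟨hD, hs⟩
  exact ⟨hD, fun h' => hs (fun x hx => h' x (M.trans _ _ _ h hx))⟩

theorem cntD_lt (M : Mdl) (X : Finset Fml) (D : Fml) (hD : D ∈ X) {a : M.W}
    (h : sat M a (.dia D)) : ∃ a', M.R a a' ∧ sat M a' D ∧ cntD M X a' < cntD M X a := by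
  classical
  obtain ⟨a', ⟨h1, h2⟩, h3⟩ := M.wf.has_min {x | M.R a x ∧ sat M x D} h
  refine ⟨a', h1, h2, ?_⟩
  apply Finset.card_lt_card
  rw [Finset.ssubset_iff_of_subset]
  · refine ⟨D, by simp only [Finset.mem_filter]; exact ⟨hD, h⟩, ?_⟩
    simp only [Finset.mem_filter]
    rintro ⟨-, x, hx, hs⟩
    exact h3 x ⟨M.trans _ _ _ h1 hx, hs⟩ hx
  · intro D
    simp only [Finset.mem_filter]
    rintro ⟨hD, x, hx, hs⟩
    exact ⟨hD, x, M.trans _ _ _ h1 hx, hs⟩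

theorem cntB_lt (M : Mdl) (X : Finset Fml) (D : Fml) (hD : D ∈ X) {a : M.W}
    (h : ¬ sat M a (.box D)) : ∃ a', M.R a a' ∧ ¬ sat M a' D ∧ cntB M X a' < cntB M X a := by
  classical
  have hne : {x | M.R a x ∧ ¬ sat M x D}.Nonempty := by
    by_contra hn
    apply h
    intro x hx
    by_contra hs
    exact hn ⟨x, hx, hs⟩
  obtain ⟨a', ⟨h1, h2⟩, h3⟩ := M.wf.has_min _ hne
  refine ⟨a', h1, h2, ?_⟩
  apply Finset.card_lt_card
  rw [Finset.ssubset_iff_of_subset]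
  · refine ⟨D, by simp only [Finset.mem_filter]; exact ⟨hD, h⟩, ?_⟩
    simp only [Finset.mem_filter]
    rintro ⟨-, hs⟩
    apply hs
    intro x hx
    by_contra hs
    exact h3 x ⟨M.trans _ _ _ h1 hx, hs⟩ hx
  · intro D
    simp only [Finset.mem_filter]
    rintro ⟨hD, hs⟩
    exact ⟨hD, fun h' => hs (fun x hx => h' x (M.trans _ _ _ h1 hx))⟩

def diaBodies : Fml → Finset Fml
  | .and A B => diaBodies A ∪ diaBodies B
  | .or A B => diaBodies A ∪ diaBodies B
  | .box A => diaBodies A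
  | .dia A => insert A (diaBodies A)
  | _ => ∅

def boxBodies : Fml → Finset Fml
  | .and A B => boxBodies A ∪ boxBodies B
  | .or A B => boxBodies A ∪ boxBodies B
  | .box A => insert A (boxBodies A)
  | .dia A => boxBodies A
  | _ => ∅

structure AW (M N : Mdl) (X Y : Finset Fml) (UA UB : Bool → Voc) where
  f : Bool
  a : M.W
  b : N.W
  k : ℕ
  hk : cntD M X a + cntB N Y b ≤ k
  sim : Sim M N (UA false ∩ UB false) k (UA f ∩ UB f) a b

def amal (M N : Mdl) (X Y : Finset Fml) (UA UB : Bool → Voc) : Mdl where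
  W := AW M N X Y UA UB
  R := fun w x => M.R w.a x.a ∧ N.R w.b x.b ∧ x.f = false
  trans := fun _ _ _ h1 h2 => ⟨M.trans _ _ _ h1.1 h2.1, N.trans _ _ _ h1.2.1 h2.2.1, h2.2.2⟩
  wf := Subrelation.wf (r := InvImage (fun x y => M.R y x) (fun w : AW M N X Y UA UB => w.a))
    (fun h => h.1) (InvImage.wf _ M.wf)
  val := fun w p => ((p, true) ∈ UA w.f ∧ M.val w.a p) ∨ ((p, false) ∈ UB w.f ∧ N.val w.b p)

theorem amal_left (M N : Mdl) (X Y : Finset Fml) (UA UB : Bool → Voc) (D : Fml) :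
    diaBodies D ⊆ X → ∀ w : (amal M N X Y UA UB).W, InVoc (UA w.f) (UA false) D →
      sat M w.a D → sat (amal M N X Y UA UB) w D := by
  induction D with
  | pos n =>
    intro _ w hv h
    exact Or.inl ⟨by simpa [Fml.uvoc] using hv.1, h⟩
  | neg n =>
    intro _ w hv h
    have hv1 : (n, false) ∈ UA w.f := by simpa [Fml.uvoc] using hv.1
    rintro (⟨_, h2⟩ | ⟨h1, h2⟩)
    · exact h h2
    · exact w.sim _ (lit_mem _ _ _ (n, false) (Finset.mem_inter.2 ⟨hv1, h1⟩)) h h2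
  | top => intros; trivial
  | bot => intro _ _ _ h; exact h
  | and A B hA hB =>
    intro hd w hv h
    simp only [diaBodies, InVoc, Fml.uvoc, Fml.vvoc, Finset.union_subset_iff] at hd hv
    exact ⟨hA hd.1 w ⟨hv.1.1, hv.2.1⟩ h.1, hB hd.2 w ⟨hv.1.2, hv.2.2⟩ h.2⟩
  | or A B hA hB =>
    intro hd w hv h
    simp only [diaBodies, InVoc, Fml.uvoc, Fml.vvoc, Finset.union_subset_iff] at hd hv
    exact h.imp (hA hd.1 w ⟨hv.1.1, hv.2.1⟩) (hB hd.2 w ⟨hv.1.2, hv.2.2⟩)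
  | box A hA =>
    intro hd w hv h x hx
    refine hA hd x ?_ (h _ hx.1)
    rw [hx.2.2]
    exact (inVoc_lits _ _).2 hv.2
  | dia A hA =>
    intro hd w hv h
    simp only [diaBodies, Finset.insert_subset_iff] at hd
    obtain ⟨a', h1, h2, h3⟩ := cntD_lt M X A hd.1 h
    obtain ⟨f, a, b, k, hk, hs⟩ := w
    cases k with
    | zero => simp only at h3; omega
    | succ k =>
      obtain ⟨b', h4, h5⟩ := sim_forth hs a' h1
      have h6 := cntB_le N Y h4
      refine ⟨⟨false, a', b', k, by simp only at h3; omega, h5⟩, ⟨h1, h4, rfl⟩, ?_⟩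
      exact hA hd.2 _ ((inVoc_lits _ _).2 hv.2) h2

theorem amal_right (M N : Mdl) (X Y : Finset Fml) (UA UB : Bool → Voc) (D : Fml) :
    boxBodies D ⊆ Y → ∀ w : (amal M N X Y UA UB).W, InVoc (UB w.f) (UB false) D →
      ¬ sat N w.b D → ¬ sat (amal M N X Y UA UB) w D := by
  induction D with
  | pos n =>
    intro _ w hv h
    have hv1 : (n, true) ∈ UB w.f := by simpa [Fml.uvoc] using hv.1
    rintro (⟨h1, h2⟩ | ⟨_, h2⟩)
    · exact h (w.sim _ (lit_mem _ _ _ (n, true) (Finset.mem_inter.2 ⟨h1, hv1⟩)) h2)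
    · exact h h2
  | neg n =>
    intro _ w hv h h'
    exact h' (Or.inr ⟨by simpa [Fml.uvoc] using hv.1, not_not.1 h⟩)
  | top => intro _ _ _ h; exact absurd trivial h
  | bot => intro _ _ _ _ h; exact h
  | and A B hA hB =>
    intro hd w hv h h'
    simp only [boxBodies, InVoc, Fml.uvoc, Fml.vvoc, Finset.union_subset_iff] at hd hv
    refine h ⟨?_, ?_⟩
    · by_contra hn
      exact hA hd.1 w ⟨hv.1.1, hv.2.1⟩ hn h'.1
    · by_contra hn
      exact hB hd.2 w ⟨hv.1.2, hv.2.2⟩ hn h'.2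
  | or A B hA hB =>
    intro hd w hv h h'
    simp only [boxBodies, InVoc, Fml.uvoc, Fml.vvoc, Finset.union_subset_iff] at hd hv
    rcases h' with h' | h'
    · exact hA hd.1 w ⟨hv.1.1, hv.2.1⟩ (fun q => h (Or.inl q)) h'
    · exact hB hd.2 w ⟨hv.1.2, hv.2.2⟩ (fun q => h (Or.inr q)) h'
  | dia A hA =>
    rintro hd w hv h ⟨x, hx, hs⟩
    refine hA hd x ?_ (fun q => h ⟨_, hx.2.1, q⟩) hs
    rw [hx.2.2]
    exact (inVoc_lits _ _).2 hv.2
  | box A hA =>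
    intro hd w hv h h'
    simp only [boxBodies, Finset.insert_subset_iff] at hd
    obtain ⟨b', h1, h2, h3⟩ := cntB_lt N Y A hd.1 h
    obtain ⟨f, a, b, k, hk, hs⟩ := w
    cases k with
    | zero => simp only at h3; omega
    | succ k =>
      obtain ⟨a', h4, h5⟩ := sim_back hs b' h1
      have h6 := cntD_le M X h4
      exact hA hd.2 ⟨false, a', b', k, by simp only at h3; omega, h5⟩
        ((inVoc_lits _ _).2 hv.2) h2 (h' _ ⟨h4, h1, rfl⟩)

theorem amal_main (A B : Fml) (h : GLH (A.imp B)) (M N : Mdl) (a : M.W) (b : N.W)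
    (hs : Sim M N (A.vvoc ∩ B.vvoc) ((diaBodies A).card + (boxBodies B).card)
      (A.uvoc ∩ B.uvoc) a b) (ha : sat M a A) : sat N b B := by
  classical
  by_contra hb
  let UA : Bool → Voc := fun f => if f then A.uvoc else A.vvoc
  let UB : Bool → Voc := fun f => if f then B.uvoc else B.vvoc
  let w : (amal M N (diaBodies A) (boxBodies B) UA UB).W :=
    ⟨true, a, b, _, Nat.add_le_add (Finset.card_filter_le _ _) (Finset.card_filter_le _ _), hs⟩
  have h1 := amal_left M N _ _ UA UB A subset_rfl w ⟨subset_rfl, subset_rfl⟩ ha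
  have h2 := amal_right M N _ _ UA UB B subset_rfl w ⟨subset_rfl, subset_rfl⟩ hb
  exact h2 ((sat_imp _ _ _ _).1 (soundness h _ w) h1)

theorem wvoc_sub {A B C : Fml} (h : InVoc (A.uvoc ∩ B.uvoc) (A.vvoc ∩ B.vvoc) C) :
    C.wvoc ⊆ A.wvoc ∩ B.wvoc := by
  obtain ⟨h1, h2⟩ := h
  rw [Finset.subset_inter_iff] at h1 h2 ⊢
  exact ⟨Finset.union_subset_union (Finset.image_subset_image h1.1)
      (Finset.image_subset_image h2.1),
    Finset.union_subset_union (Finset.image_subset_image h1.2) (Finset.image_subset_image h2.2)⟩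

end LIP

theorem lyndon_interpolation (A B : Fml) (h : GLH (A.imp B)) :
    ∃ C : Fml, C.wvoc ⊆ A.wvoc ∩ B.wvoc ∧ GLH (A.imp C) ∧ GLH (C.imp B) := by
  classical
  let Fs := LIP.F (A.vvoc ∩ B.vvoc) ((LIP.diaBodies A).card + (LIP.boxBodies B).card)
    (A.uvoc ∩ B.uvoc)
  let Q := (Fs.powerset.filter (fun S => GLH ((LIP.conj S).imp B))).image LIP.conj
  refine ⟨LIP.disj Q, LIP.wvoc_sub (LIP.inVoc_disj _ _ _ ?_), ?_, ?_⟩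
  · intro D hD
    obtain ⟨S, hS, rfl⟩ := Finset.mem_image.1 hD
    have hS' := Finset.mem_powerset.1 (Finset.mem_filter.1 hS).1
    exact LIP.inVoc_conj _ _ _ (fun E hE => LIP.F_voc _ _ _ E (hS' hE))
  · apply LIP.completeness
    intro M a
    rw [LIP.sat_imp, LIP.sat_disj]
    intro ha
    refine ⟨LIP.conj (Fs.filter (fun D => LIP.sat M a D)), Finset.mem_image_of_mem _
      (Finset.mem_filter.2 ⟨Finset.mem_powerset.2 (Finset.filter_subset _ _), ?_⟩), ?_⟩
    · apply LIP.completeness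
      intro N b
      rw [LIP.sat_imp, LIP.sat_conj]
      intro hb
      exact LIP.amal_main A B h M N a b
        (fun D hD hs => hb D (Finset.mem_filter.2 ⟨hD, hs⟩)) ha
    · rw [LIP.sat_conj]
      exact fun D hD => (Finset.mem_filter.1 hD).2
  · apply LIP.completeness
    intro N b
    rw [LIP.sat_imp, LIP.sat_disj]
    rintro ⟨D, hD, hs⟩
    obtain ⟨S, hS, rfl⟩ := Finset.mem_image.1 hD
    exact (LIP.sat_imp _ _ _ _).1 (LIP.soundness (Finset.mem_filter.1 hS).2 N b) hs
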